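/- Let M = {(z, w) ∈ ℂ² : z ≠ 0, w ≠ 0, and z + w ≠ 1}, the complement of the arrangement of the three hyperplanes x = 0, y = 0, x + y = 1 in ℂ², and fix a basepoint m ∈ M. Then the fundamental group π₁(M, m) is isomorphic to ℤ³, the free abelian group of rank three. -/

import Mathlib

open scoped Topology

section SimplyConnected

variable {X : Type*} [TopologicalSpace X]

/-- Two paths inside a simply connected set with the same endpoints are homotopic. -/
lemma IsSimplyConnected.homotopic {U : Set X} (hU : IsSimplyConnected U) {x y : X}
    {p q : Path x y} (hp : ∀ t, p t ∈ U) (hq : ∀ t, q t ∈ U) : p.Homotopic q := by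
  have := hU.simplyConnectedSpace
  have hx : x ∈ U := by simpa using hp 0
  have hy : y ∈ U := by simpa using hp 1
  let lift (r : Path x y) (hr : ∀ t, r t ∈ U) : Path (⟨x, hx⟩ : U) ⟨y, hy⟩ :=
    { toFun := fun t ↦ ⟨r t, hr t⟩
      source' := by simp
      target' := by simp }
  exact (SimplyConnectedSpace.paths_homotopic (lift p hp) (lift q hq)).map
    ⟨Subtype.val, continuous_subtype_val⟩

/-- A space is simply connected as soon as its points can be joined to a base point by path
classes which are locally compatible with each other. -/
lemma SimplyConnectedSpace.of_pathClasses {x₀ : X} (c : ∀ x, Path.Homotopic.Quotient x₀ x)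
    (hc : ∀ y, ∃ U ∈ 𝓝 y, ∀ ⦃a b⦄ (γ : Path a b), (∀ t, γ t ∈ U) →
      (c a).trans (.mk γ) = c b) : SimplyConnectedSpace X := by
  have key : ∀ ⦃a b⦄ (γ : Path a b), (c a).trans (.mk γ) = c b := by
    intro a b γ
    choose U hU hUc using hc
    obtain ⟨t, ht0, hmono, ⟨N, hN⟩, ht⟩ := exists_monotone_Icc_subset_open_cover_unitInterval
      (c := fun y ↦ γ ⁻¹' interior (U y)) (fun y ↦ isOpen_interior.preimage γ.continuous)
      (fun s _ ↦ Set.mem_iUnion.2 ⟨γ s, mem_interior_iff_mem_nhds.2 (hU _)⟩)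
    have step : ∀ n, (c (γ 0)).trans (.mk (γ.subpath 0 (t n))) = c (γ (t n)) := by
      intro n
      induction n with
      | zero =>
        rw [ht0, Path.subpath_self]
        simp
      | succ n ih =>
        obtain ⟨y, hy⟩ := ht n
        have h1 : Path.Homotopic.Quotient.mk (γ.subpath 0 (t (n + 1))) =
            (Path.Homotopic.Quotient.mk (γ.subpath 0 (t n))).trans
              (.mk (γ.subpath (t n) (t (n + 1)))) := by
          rw [← Path.Homotopic.Quotient.mk_trans]
          exact (Path.Homotopic.Quotient.eq.2
            ⟨Path.Homotopy.subpathTransSubpath γ 0 (t n) (t (n + 1))⟩).symm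
        rw [h1, ← Path.Homotopic.Quotient.trans_assoc, ih]
        refine hUc y _ fun s ↦ ?_
        have hs : γ.subpath (t n) (t (n + 1)) s ∈ Set.range (γ.subpath (t n) (t (n + 1))) :=
          ⟨s, rfl⟩
        rw [Path.range_subpath_of_le _ _ _ (hmono n.le_succ)] at hs
        obtain ⟨r, hr, hrs⟩ := hs
        rw [← hrs]
        exact interior_subset (hy hr)
    have h1 := step N
    rw [hN N le_rfl, Path.subpath_zero_one] at h1
    have uncast : ∀ {a' b'} (ha : a' = a) (hb : b' = b),
        (c a').trans (.mk (γ.cast ha hb)) = c b' → (c a).trans (.mk γ) = c b := by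
      rintro _ _ rfl rfl h
      exact h
    exact uncast _ _ h1
  rw [simply_connected_iff_paths_homotopic']
  refine ⟨⟨⟨x₀⟩, fun x y ↦ ⟨(c x).out.symm.trans (c y).out⟩⟩, fun {x y} p q ↦ ?_⟩
  rw [← Path.Homotopic.Quotient.eq]
  have h := (key p).trans (key q).symm
  calc Path.Homotopic.Quotient.mk p = (c x).symm.trans ((c x).trans (.mk p)) := by
        rw [← Path.Homotopic.Quotient.trans_assoc]; simp
    _ = .mk q := by rw [h, ← Path.Homotopic.Quotient.trans_assoc]; simp

lemma Path.trans_mem {V : Set X} {a b c : X} {r : Path a b} {s : Path b c}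
    (hr : ∀ t, r t ∈ V) (hs : ∀ t, s t ∈ V) (t : unitInterval) : r.trans s t ∈ V := by
  have ht : r.trans s t ∈ Set.range (r.trans s) := ⟨t, rfl⟩
  rw [Path.trans_range] at ht
  rcases ht with ⟨t, ht⟩ | ⟨t, ht⟩
  exacts [ht ▸ hr t, ht ▸ hs t]

open Path in
/-- A space covered by three families of simply connected open sets is simply connected if the
members of each family are pairwise disjoint, members of different families have path connected
intersection, and any three members of the three families have a common point. -/
lemma SimplyConnectedSpace.of_three_families {κ : Type*} [Nonempty κ] (U : Fin 3 → κ → Set X)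
    (hopen : ∀ i k, IsOpen (U i k)) (hsc : ∀ i k, IsSimplyConnected (U i k))
    (hdisj : ∀ i k l x, x ∈ U i k → x ∈ U i l → k = l)
    (hconn : ∀ i j k l, i ≠ j → IsPathConnected (U i k ∩ U j l))
    (p : (Fin 3 → κ) → X) (hp : ∀ v i, p v ∈ U i (v i))
    (hcover : ∀ x, ∃ i k, x ∈ U i k) : SimplyConnectedSpace X := by
  obtain ⟨o⟩ := ‹Nonempty κ›
  let v : Fin 3 → κ → Fin 3 → κ := fun i k ↦ Function.update (fun _ ↦ o) i k
  have v_self : ∀ i k, v i k i = k := fun i k ↦ by simp [v]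
  have v_ne : ∀ i k h, h ≠ i → v i k h = o := fun i k h hne ↦ by simp [v, hne]
  have pv_self : ∀ i k, p (v i k) ∈ U i k := fun i k ↦ by simpa [v_self] using hp (v i k) i
  have pv_ne : ∀ i k h, h ≠ i → p (v i k) ∈ U h o := fun i k h hne ↦ by
    simpa [v_ne i k h hne] using hp (v i k) h
  have hpo : ∀ i, p (fun _ ↦ o) ∈ U i o := fun i ↦ hp (fun _ ↦ o) i
  have third : ∀ i j : Fin 3, i ≠ j → ∃ h, h ≠ i ∧ h ≠ j := by decide
  have others : ∀ i : Fin 3, ∃ h h', h ≠ i ∧ h' ≠ i ∧ h ≠ h' ∧ ∀ g, g ≠ i → g = h ∨ g = h' := by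
    decide
  have hspoke : ∀ i k, ∃ e : Path (p fun _ ↦ o) (p (v i k)), ∀ h, h ≠ i → ∀ t, e t ∈ U h o := by
    intro i k
    obtain ⟨h, h', hi, hi', hne, hall⟩ := others i
    obtain ⟨e, he⟩ := (hconn h h' o o hne).joinedIn _ ⟨hpo h, hpo h'⟩ _
      ⟨pv_ne i k h hi, pv_ne i k h' hi'⟩
    refine ⟨e, fun g hg t ↦ ?_⟩
    rcases hall g hg with rfl | rfl
    exacts [(he t).1, (he t).2]
  choose e he using hspoke
  have compat : ∀ i j k l x (α : Path (p (v i k)) x) (β : Path (p (v j l)) x),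
      (∀ t, α t ∈ U i k) → (∀ t, β t ∈ U j l) →
      (Homotopic.Quotient.mk (e i k)).trans (.mk α) =
        (Homotopic.Quotient.mk (e j l)).trans (.mk β) := by
    intro i j k l x α β hα hβ
    have hx : x ∈ U i k ∩ U j l := ⟨by simpa using hα 1, by simpa using hβ 1⟩
    by_cases hij : i = j
    · subst hij
      obtain rfl := hdisj i k l x hx.1 hx.2
      rw [Homotopic.Quotient.eq.2 ((hsc i k).homotopic hα hβ)]
    · obtain ⟨h, hhi, hhj⟩ := third i j hij
      let w : Fin 3 → κ := Function.update (v i k) j l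
      have hwi : p w ∈ U i k := by simpa [w, hij, v_self] using hp w i
      have hwj : p w ∈ U j l := by simpa [w] using hp w j
      have hwh : p w ∈ U h o := by simpa [w, hhj, v_ne i k h hhi] using hp w h
      obtain ⟨δ, hδ⟩ := (hconn i j k l hij).joinedIn _ ⟨hwi, hwj⟩ _ hx
      obtain ⟨σ, hσ⟩ := (hconn i h k o hhi.symm).joinedIn _ ⟨pv_self i k, pv_ne i k h hhi⟩ _
        ⟨hwi, hwh⟩
      obtain ⟨τ, hτ⟩ := (hconn j h l o hhj.symm).joinedIn _ ⟨pv_self j l, pv_ne j l h hhj⟩ _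
        ⟨hwj, hwh⟩
      have h1 : Homotopic.Quotient.mk α = (Homotopic.Quotient.mk σ).trans (.mk δ) := by
        rw [← Homotopic.Quotient.mk_trans, Homotopic.Quotient.eq]
        exact (hsc i k).homotopic hα (trans_mem (fun t ↦ (hσ t).1) fun t ↦ (hδ t).1)
      have h2 : Homotopic.Quotient.mk β = (Homotopic.Quotient.mk τ).trans (.mk δ) := by
        rw [← Homotopic.Quotient.mk_trans, Homotopic.Quotient.eq]
        exact (hsc j l).homotopic hβ (trans_mem (fun t ↦ (hτ t).1) fun t ↦ (hδ t).2)
      have h3 : (Homotopic.Quotient.mk (e i k)).trans (.mk σ) =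
          (Homotopic.Quotient.mk (e j l)).trans (.mk τ) := by
        rw [← Homotopic.Quotient.mk_trans, ← Homotopic.Quotient.mk_trans, Homotopic.Quotient.eq]
        exact (hsc h o).homotopic (trans_mem (he i k h hhi) fun t ↦ (hσ t).2)
          (trans_mem (he j l h hhj) fun t ↦ (hτ t).2)
      rw [h1, h2, ← Homotopic.Quotient.trans_assoc, h3, Homotopic.Quotient.trans_assoc]
  choose I K hIK using hcover
  have hjoin : ∀ x, ∃ α : Path (p (v (I x) (K x))) x, ∀ t, α t ∈ U (I x) (K x) := fun x ↦
    (hsc _ _).isPathConnected.joinedIn _ (pv_self _ _) _ (hIK x)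
  choose α hα using hjoin
  refine .of_pathClasses (fun x ↦ (Homotopic.Quotient.mk (e (I x) (K x))).trans (.mk (α x))) fun y ↦
    ⟨_, (hopen _ _).mem_nhds (hIK y), fun a b γ hγ ↦ ?_⟩
  obtain ⟨β, hβ⟩ := (hsc (I y) (K y)).isPathConnected.joinedIn _ (pv_self _ _) a
    (by simpa using hγ 0)
  rw [compat _ _ _ _ a (α a) β (hα a) hβ, Homotopic.Quotient.trans_assoc,
    ← Homotopic.Quotient.mk_trans]
  exact compat _ _ _ _ b _ _ (trans_mem hβ hγ) (hα b)

end SimplyConnected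

section Segment

variable {E : Type*} [AddCommGroup E] [Module ℝ E] [TopologicalSpace E] [ContinuousAdd E]
  [ContinuousSMul ℝ E]

/-- Two maps into a set are homotopic if the segments between their values stay in the set. -/
lemma ContinuousMap.homotopic_of_segment_subset {Y : Type*} [TopologicalSpace Y] {T : Set E}
    (f g : C(Y, T)) (h : ∀ y, segment ℝ (f y : E) (g y) ⊆ T) : f.Homotopic g :=
  ⟨{ toFun := fun q ↦ ⟨(1 - q.1 : ℝ) • (f q.2 : E) + (q.1 : ℝ) • (g q.2 : E),
        h q.2 ⟨1 - q.1, q.1, sub_nonneg.2 q.1.2.2, q.1.2.1, by ring, rfl⟩⟩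
     continuous_toFun := by fun_prop
     map_zero_left := fun y ↦ by simp
     map_one_left := fun y ↦ by simp }⟩

/-- A set is contractible if it can be pushed along segments into a convex subset. -/
lemma ContractibleSpace.of_segment_subset {T K : Set E} (hKT : K ⊆ T) (hK : Convex ℝ K)
    (hne : K.Nonempty) {g : T → E} (hg : Continuous g) (hgK : ∀ x, g x ∈ K)
    (hseg : ∀ x : T, segment ℝ (x : E) (g x) ⊆ T) : ContractibleSpace T := by
  obtain ⟨k, hk⟩ := hne
  let g' : C(T, T) := ⟨fun x ↦ ⟨g x, hKT (hgK x)⟩, by fun_prop⟩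
  rw [contractible_iff_id_nullhomotopic]
  refine ⟨⟨k, hKT hk⟩, .trans (ContinuousMap.homotopic_of_segment_subset _ g' hseg)
    (ContinuousMap.homotopic_of_segment_subset _ _ fun x ↦ ?_)⟩
  exact (hK.segment_subset (hgK x) hk).trans hKT

end Segment

namespace Complex

/-- The pairs `(b, d)` for which `1 - exp b - exp (b + d)` has a principal logarithm. -/
def slitDomain : Set (ℂ × ℂ) := {q | 1 - exp q.1 * (1 + exp q.2) ∈ slitPlane}

lemma one_sub_mul_mem_slitPlane {z : ℂ} (hz : 1 - z ∈ slitPlane) {r : ℝ} (h₀ : 0 ≤ r)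
    (h₁ : r ≤ 1) : 1 - r * z ∈ slitPlane := by
  have := starConvex_one_slitPlane hz (sub_nonneg.2 h₁) h₀ (by ring)
  convert this using 1
  simp only [real_smul]
  push_cast
  ring

lemma norm_exp_mul_lt_one {b d : ℂ} (h : 1 + Real.exp ‖d‖ ≤ -b.re) :
    ‖exp b * (1 + exp d)‖ < 1 := by
  set x := 1 + Real.exp ‖d‖
  have h0 : 0 < Real.exp ‖d‖ := Real.exp_pos _
  have h1 : ‖1 + exp d‖ ≤ x := (norm_add_le _ _).trans (by
    rw [norm_one, norm_exp]
    exact add_le_add le_rfl (Real.exp_le_exp.2 (re_le_norm d)))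
  have h2 : x < Real.exp x := by linarith [Real.add_one_le_exp x]
  rw [norm_mul, norm_exp]
  calc Real.exp b.re * ‖1 + exp d‖ ≤ Real.exp (-x) * x := by
        gcongr
        linarith
    _ < Real.exp (-x) * Real.exp x := by gcongr
    _ = 1 := by rw [← Real.exp_add]; simp

lemma contractibleSpace_slitDomain : ContractibleSpace slitDomain := by
  refine .of_segment_subset (K := {q : ℂ × ℂ | 1 + Real.exp ‖q.2‖ ≤ -q.1.re})
    (g := fun q ↦ (q.1.1 - ((|q.1.1.re| + 1 + Real.exp ‖q.1.2‖ : ℝ) : ℂ), q.1.2)) ?_ ?_ ?_ ?_ ?_ ?_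
  · intro q hq
    have := mem_slitPlane_of_norm_lt_one (z := -(exp q.1 * (1 + exp q.2)))
      (by simpa only [norm_neg] using norm_exp_mul_lt_one hq)
    simpa only [slitDomain, Set.mem_ofPred_eq, sub_eq_add_neg] using this
  · rintro ⟨b, d⟩ hq ⟨b', d'⟩ hq' s t hs ht hst
    simp only [Set.mem_ofPred_eq] at hq hq'
    have h1 : Real.exp ‖s • d + t • d'‖ ≤ s * Real.exp ‖d‖ + t * Real.exp ‖d'‖ := by
      refine (Real.exp_le_exp.2 ((norm_add_le _ _).trans ?_)).trans
        (convexOn_exp.2 (Set.mem_univ ‖d‖) (Set.mem_univ ‖d'‖) hs ht hst)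
      rw [norm_smul, norm_smul, Real.norm_of_nonneg hs, Real.norm_of_nonneg ht]
      rfl
    have h2 : (s • b + t • b').re = s * b.re + t * b'.re := by simp
    simp only [Set.mem_ofPred_eq, Prod.smul_mk, Prod.mk_add_mk, h2]
    nlinarith
  · refine ⟨(-2, 0), ?_⟩
    norm_num
  · fun_prop
  · intro q
    simp only [Set.mem_ofPred_eq, sub_re, ofReal_re]
    linarith [le_abs_self q.1.1.re]
  · rintro ⟨q, hq⟩ _ ⟨s, t, hs, ht, hst, rfl⟩
    set R := |q.1.re| + 1 + Real.exp ‖q.2‖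
    have h0 : 0 ≤ R := by positivity
    have h1 : Real.exp (-(t * R)) ≤ 1 := Real.exp_le_one_iff.2 (by nlinarith)
    have := one_sub_mul_mem_slitPlane hq (Real.exp_pos _).le h1
    obtain rfl : s = 1 - t := by linarith
    have e1 : (1 - t) • q.1 + t • (q.1 - (R : ℂ)) = q.1 + ((-(t * R) : ℝ) : ℂ) := by
      simp only [real_smul]; push_cast; ring
    have e2 : (1 - t) • q.2 + t • q.2 = q.2 := by
      simp only [real_smul]; push_cast; ring
    simp only [slitDomain, Set.mem_ofPred_eq, Prod.smul_mk, Prod.fst_add, Prod.snd_add,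
      Prod.smul_fst, Prod.smul_snd, e1, e2, exp_add, ← ofReal_exp]
    convert this using 2
    ring

open Real (pi_pos)

lemma exp_mem_slitPlane_of_abs_im_lt {z : ℂ} (hz : |z.im| < Real.pi) : exp z ∈ slitPlane := by
  rw [mem_slitPlane_iff_arg, ← log_im, log_exp (abs_lt.1 hz).1 (abs_lt.1 hz).2.le]
  exact ⟨(abs_lt.1 hz).2.ne, exp_ne_zero z⟩

lemma log_exp_of_abs_im_lt {z : ℂ} (hz : |z.im| < Real.pi) : log (exp z) = z :=
  log_exp (abs_lt.1 hz).1 (abs_lt.1 hz).2.le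

lemma abs_log_im_lt {z : ℂ} (hz : z ∈ slitPlane) : |(log z).im| < Real.pi := by
  rw [log_im]
  exact (abs_arg_le_pi z).lt_of_ne fun h ↦ (mem_slitPlane_iff_arg.1 hz).1 (by
    rcases abs_eq Real.pi_pos.le |>.1 h with h | h
    exacts [h, absurd h (neg_pi_lt_arg z).ne'])

/-- The complement of the coordinate hyperplanes in the plane `y 0 + y 1 + y 2 = 1`. -/
def planeComplement : Set (Fin 3 → ℂ) := {y | ∑ i, y i = 1 ∧ ∀ i, y i ≠ 0}

/-- The logarithmic cover of `planeComplement`. -/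
def logCover : Set (Fin 3 → ℂ) := (fun f i ↦ exp (f i)) ⁻¹' planeComplement

lemma mem_logCover {f : Fin 3 → ℂ} : f ∈ logCover ↔ ∑ i, exp (f i) = 1 := by
  simp [logCover, planeComplement, exp_ne_zero]

lemma exp_add_two_pi_mul_int (z : ℂ) (n : ℤ) : exp (z + n * (2 * Real.pi * I)) = exp z :=
  exp_eq_exp_iff_exists_int.2 ⟨n, rfl⟩

lemma add_two_pi_mul_int_im (z : ℂ) (n : ℤ) :
    (z + n * (2 * Real.pi * I)).im = z.im + 2 * Real.pi * n := by
  simp [mul_comm]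

namespace logCover

noncomputable instance : AddAction (Fin 3 → ℤ) logCover where
  vadd v f := ⟨fun i ↦ f.1 i + v i * (2 * Real.pi * I), by
    simpa only [mem_logCover, exp_add_two_pi_mul_int] using mem_logCover.1 f.2⟩
  zero_vadd f := Subtype.ext <| funext fun i ↦ by
    change f.1 i + ((0 : ℤ) : ℂ) * _ = _
    simp
  add_vadd v w f := Subtype.ext <| funext fun i ↦ by
    change f.1 i + ((v i + w i : ℤ) : ℂ) * _ = f.1 i + w i * _ + v i * _
    push_cast
    ring

lemma vadd_apply (v : Fin 3 → ℤ) (f : logCover) (i : Fin 3) :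
    (v +ᵥ f).1 i = f.1 i + v i * (2 * Real.pi * I) := rfl

lemma continuous_coord (i : Fin 3) : Continuous fun f : logCover ↦ f.1 i :=
  (continuous_apply i).comp continuous_subtype_val

instance : ContinuousConstVAdd (Fin 3 → ℤ) logCover where
  continuous_const_vadd _ :=
    .subtype_mk (continuous_pi fun i ↦ (continuous_coord i).add continuous_const) _

/-- The part of the logarithmic cover where the `k`-th branch of the logarithm applies to the
`i`-th coordinate. -/
def strip (i : Fin 3) (k : ℤ) : Set logCover := {f | |(f.1 i).im - 2 * Real.pi * k| < Real.pi}

lemma isOpen_strip (i : Fin 3) (k : ℤ) : IsOpen (strip i k) :=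
  isOpen_lt ((continuous_im.comp (continuous_coord i)).sub continuous_const).abs continuous_const

lemma strip_disjoint {i : Fin 3} {k l : ℤ} {f : logCover} (hk : f ∈ strip i k)
    (hl : f ∈ strip i l) : k = l := by
  rw [strip, Set.mem_ofPred_eq, abs_lt] at hk hl
  have h1 : (k : ℝ) < l + 1 := by nlinarith [pi_pos]
  have h2 : (l : ℝ) < k + 1 := by nlinarith [pi_pos]
  norm_cast at h1 h2
  lia

lemma exists_mem_strip (f : logCover) : ∃ i k, f ∈ strip i k := by
  obtain ⟨i, hi⟩ : ∃ i, exp (f.1 i) ∈ slitPlane := by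
    by_contra! h
    have h1 : (∑ i, exp (f.1 i)).re ≤ 0 := by
      rw [re_sum]
      exact Finset.sum_nonpos fun i _ ↦ not_lt.1 fun hi ↦ h i (.inl hi)
    rw [mem_logCover.1 f.2] at h1
    norm_num at h1
  obtain ⟨k, hk⟩ := exp_eq_exp_iff_exists_int.1 (exp_log (exp_ne_zero (f.1 i))).symm
  refine ⟨i, k, ?_⟩
  rw [strip, Set.mem_ofPred_eq, hk, add_two_pi_mul_int_im, add_sub_cancel_right]
  exact abs_log_im_lt hi

lemma exists_forall_mem_strip (v : Fin 3 → ℤ) : ∃ f : logCover, ∀ i, f ∈ strip i (v i) := by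
  refine ⟨⟨fun i ↦ log (1 / 3) + v i * (2 * Real.pi * I), ?_⟩, fun i ↦ ?_⟩
  · simp only [mem_logCover, exp_add_two_pi_mul_int]
    rw [exp_log (by norm_num)]
    norm_num
  · rw [strip, Set.mem_ofPred_eq, add_two_pi_mul_int_im, add_sub_cancel_right]
    exact abs_log_im_lt (.inl (by norm_num))

/-- Permutations of the coordinates act on the logarithmic cover. -/
def permute (e : Equiv.Perm (Fin 3)) : logCover ≃ₜ logCover where
  toFun f := ⟨fun i ↦ f.1 (e i), by
    rw [mem_logCover, Equiv.sum_comp e fun i ↦ exp (f.1 i)]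
    exact mem_logCover.1 f.2⟩
  invFun f := ⟨fun i ↦ f.1 (e.symm i), by
    rw [mem_logCover, Equiv.sum_comp e.symm fun i ↦ exp (f.1 i)]
    exact mem_logCover.1 f.2⟩
  left_inv f := by simp
  right_inv f := by simp
  continuous_toFun := .subtype_mk (continuous_pi fun _ ↦ continuous_coord _) _
  continuous_invFun := .subtype_mk (continuous_pi fun _ ↦ continuous_coord _) _

lemma vadd_mem_strip {v : Fin 3 → ℤ} {f : logCover} {i : Fin 3} :
    v +ᵥ f ∈ strip i 0 ↔ f ∈ strip i (-v i) := by
  rw [strip, strip, Set.mem_ofPred_eq, Set.mem_ofPred_eq, vadd_apply, add_two_pi_mul_int_im]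
  simp

lemma exists_homeomorph {i j : Fin 3} (hij : i ≠ j) (k l : ℤ) : ∃ e : logCover ≃ₜ logCover,
    e ⁻¹' strip 0 0 = strip i k ∧ e ⁻¹' strip 1 0 = strip j l := by
  obtain ⟨s, rfl, rfl⟩ : ∃ s : Equiv.Perm (Fin 3), s 0 = i ∧ s 1 = j := by
    revert i j
    decide
  let v : Fin 3 → ℤ := fun h ↦ if h = s 0 then -k else -l
  have hk : -v (s 0) = k := by simp [v]
  have hl : -v (s 1) = l := by simp [v]
  refine ⟨(Homeomorph.vadd v).trans (permute s), ?_, ?_⟩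
  · ext f
    exact (vadd_mem_strip (v := v) (f := f) (i := s 0)).trans (by rw [hk])
  · ext f
    exact (vadd_mem_strip (v := v) (f := f) (i := s 1)).trans (by rw [hl])

lemma exp_zero_add {f : Fin 3 → ℂ} (hf : f ∈ logCover) :
    exp (f 0) = 1 - exp (f 1) * (1 + exp (f 2 - f 1)) := by
  have h := mem_logCover.1 hf
  rw [Fin.sum_univ_three] at h
  rw [mul_add, ← exp_add, add_sub_cancel]
  linear_combination h

lemma mem_strip_zero {i : Fin 3} {f : logCover} : f ∈ strip i 0 ↔ |(f.1 i).im| < Real.pi := by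
  simp [strip]

/-- The basic strip of the logarithmic cover is a graph over `slitDomain`. -/
noncomputable def stripHomeomorph : strip 0 0 ≃ₜ slitDomain where
  toFun f := ⟨(f.1.1 1, f.1.1 2 - f.1.1 1), by
    rw [slitDomain, Set.mem_ofPred_eq, ← exp_zero_add f.1.2]
    exact exp_mem_slitPlane_of_abs_im_lt (mem_strip_zero.1 f.2)⟩
  invFun q := ⟨⟨![log (1 - exp q.1.1 * (1 + exp q.1.2)), q.1.1, q.1.1 + q.1.2], by
      simp only [mem_logCover, Fin.sum_univ_three, Matrix.cons_val, exp_add,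
        exp_log (slitPlane_ne_zero q.2)]
      ring⟩, mem_strip_zero.2 (abs_log_im_lt q.2)⟩
  left_inv f := by
    ext i
    have := exp_zero_add f.1.2
    fin_cases i
    · simpa [← this] using log_exp_of_abs_im_lt (mem_strip_zero.1 f.2)
    · rfl
    · simp
  right_inv q := by simp
  continuous_toFun := by
    have h (i : Fin 3) : Continuous fun f : strip 0 0 ↦ f.1.1 i :=
      (continuous_coord i).comp continuous_subtype_val
    exact .subtype_mk ((h 1).prodMk ((h 2).sub (h 1))) _
  continuous_invFun := by
    refine .subtype_mk (.subtype_mk (continuous_pi fun i ↦ ?_) _) _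
    fin_cases i
    · exact Continuous.clog (by fun_prop) fun q ↦ q.2
    · change Continuous fun q : slitDomain ↦ q.1.1
      fun_prop
    · change Continuous fun q : slitDomain ↦ q.1.1 + q.1.2
      fun_prop

lemma isSimplyConnected_strip (i : Fin 3) (k : ℤ) : IsSimplyConnected (strip i k) := by
  obtain ⟨j, hij⟩ : ∃ j, i ≠ j := (exists_ne i).imp fun _ ↦ Ne.symm
  obtain ⟨e, he, -⟩ := exists_homeomorph hij k 0
  rw [← he, Homeomorph.isSimplyConnected_preimage]
  have := contractibleSpace_slitDomain
  exact stripHomeomorph.toHomotopyEquiv.simplyConnectedSpace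

/-- Pairs of points `z`, `w` of the slit plane such that `1 - z - w` lies in the slit plane
up to the sign `(-1) ^ n`. -/
def slitPair (n : ℤ) : Set (ℂ × ℂ) :=
  {q | q.1 ∈ slitPlane ∧ q.2 ∈ slitPlane ∧ (-1) ^ n * (1 - q.1 - q.2) ∈ slitPlane}

lemma isPathConnected_slitPair (n : ℤ) : IsPathConnected (slitPair n) := by
  have key : ∀ x y : ℝ, 0 < x → 0 < y → (-1) ^ n * (1 - (x : ℂ) - x) = y →
      IsPathConnected (slitPair n) := by
    intro x y hx hy hxy
    refine StarConvex.isPathConnected (a := ((x : ℂ), (x : ℂ))) ?_ ?_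
    · intro q hq s t hs ht hst
      refine ⟨starConvex_ofReal_slitPlane hx hq.1 hs ht hst,
        starConvex_ofReal_slitPlane hx hq.2.1 hs ht hst, ?_⟩
      convert starConvex_ofReal_slitPlane hy hq.2.2 hs ht hst using 1
      rw [← hxy]
      have : (s : ℂ) + t = 1 := by exact_mod_cast hst
      simp
      linear_combination -(-1) ^ n * this
    · refine ⟨ofReal_mem_slitPlane.2 hx, ofReal_mem_slitPlane.2 hx, ?_⟩
      rw [hxy]
      exact ofReal_mem_slitPlane.2 hy
  rcases n.even_or_odd with hn | hn
  · refine key (1 / 3) (1 / 3) (by norm_num) (by norm_num) ?_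
    rw [hn.neg_one_zpow]
    norm_num
  · refine key 1 1 (by norm_num) (by norm_num) ?_
    rw [hn.neg_one_zpow]
    norm_num

lemma exp_int_mul_pi_mul_I (n : ℤ) : exp (n * (Real.pi * I)) = (-1) ^ n := by
  rw [exp_int_mul, exp_pi_mul_I]

lemma neg_one_zpow_mul_self (n : ℤ) : ((-1) ^ n * (-1) ^ n : ℂ) = 1 := by
  rw [← mul_zpow]; simp

/-- The branch of the inverse of the exponential over `slitPair n`. -/
noncomputable def slitPairLift (n : ℤ) (q : slitPair n) : logCover :=
  ⟨![log q.1.1, log q.1.2, log ((-1) ^ n * (1 - q.1.1 - q.1.2)) + n * (Real.pi * I)], by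
    simp only [mem_logCover, Fin.sum_univ_three, Matrix.cons_val, exp_add, exp_int_mul_pi_mul_I,
      exp_log (slitPlane_ne_zero q.2.1), exp_log (slitPlane_ne_zero q.2.2.1),
      exp_log (slitPlane_ne_zero q.2.2.2)]
    linear_combination (1 - q.1.1 - q.1.2) * neg_one_zpow_mul_self n⟩

lemma continuous_slitPairLift (n : ℤ) : Continuous (slitPairLift n) := by
  refine .subtype_mk (continuous_pi fun i ↦ ?_) _
  fin_cases i
  · exact Continuous.clog (by fun_prop) fun q ↦ q.2.1
  · exact Continuous.clog (by fun_prop) fun q ↦ q.2.2.1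
  · exact (Continuous.clog (by fun_prop) fun q ↦ q.2.2.2).add continuous_const

lemma slitPairLift_mem (n : ℤ) (q : slitPair n) : slitPairLift n q ∈ strip 0 0 ∩ strip 1 0 :=
  ⟨mem_strip_zero.2 (abs_log_im_lt q.2.1), mem_strip_zero.2 (abs_log_im_lt q.2.2.1)⟩

lemma exists_slitPairLift_eq {f : logCover} (hf : f ∈ strip 0 0 ∩ strip 1 0) :
    ∃ n q, slitPairLift n q = f := by
  have hf₀ := mem_strip_zero.1 hf.1
  have hf₁ := mem_strip_zero.1 hf.2
  set n := ⌊(f.1 2).im / Real.pi⌋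
  have h1 : |(f.1 2 + (-n : ℤ) * (Real.pi * I)).im| < Real.pi := by
    have h2 : (n : ℝ) * Real.pi ≤ (f.1 2).im := (le_div_iff₀ pi_pos).1 (Int.floor_le _)
    have h3 : (f.1 2).im < (n + 1) * Real.pi := (div_lt_iff₀ pi_pos).1 (Int.lt_floor_add_one _)
    simp [abs_lt]
    constructor <;> linarith [pi_pos]
  have h4 : (-1) ^ n * (1 - exp (f.1 0) - exp (f.1 1)) =
      exp (f.1 2 + (-n : ℤ) * (Real.pi * I)) := by
    have h := mem_logCover.1 f.2
    rw [Fin.sum_univ_three] at h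
    rw [exp_add, exp_int_mul_pi_mul_I, zpow_neg, ← inv_zpow, inv_neg_one]
    linear_combination -(-1) ^ n * h
  refine ⟨n, ⟨(exp (f.1 0), exp (f.1 1)), exp_mem_slitPlane_of_abs_im_lt hf₀,
    exp_mem_slitPlane_of_abs_im_lt hf₁, ?_⟩, ?_⟩
  · simp only [h4]
    exact exp_mem_slitPlane_of_abs_im_lt h1
  · ext i
    simp only [slitPairLift, h4]
    fin_cases i
    · exact log_exp_of_abs_im_lt hf₀
    · exact log_exp_of_abs_im_lt hf₁
    · simp only [log_exp_of_abs_im_lt h1]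
      simp

lemma slitPairLift_inter (n : ℤ) :
    (Set.range (slitPairLift n) ∩ Set.range (slitPairLift (n + 1))).Nonempty := by
  set s : ℂ := (-1) ^ n with hs
  have hs1 : (-1) ^ (n + 1) = -s := by rw [zpow_add₀ (by norm_num)]; simp [hs]
  have hss : s * s = 1 := neg_one_zpow_mul_self n
  have h1 : s * (1 - (1 - s * I) / 2 - (1 - s * I) / 2) = I := by linear_combination I * hss
  have hz : (1 - s * I) / 2 ∈ slitPlane := by
    left
    rcases n.even_or_odd with hn | hn <;> simp [hs, hn.neg_one_zpow]
  have hI : log (-I) + Real.pi * I = log I := by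
    rw [log_neg_I, log_I]; ring
  refine ⟨slitPairLift n ⟨((1 - s * I) / 2, (1 - s * I) / 2), hz, hz, ?_⟩, ⟨_, rfl⟩,
    ⟨((1 - s * I) / 2, (1 - s * I) / 2), hz, hz, ?_⟩, ?_⟩
  · simp only [← hs, h1]
    simp [mem_slitPlane_iff]
  · simp only [hs1, neg_mul, h1]
    simp [mem_slitPlane_iff]
  · ext i
    fin_cases i
    · rfl
    · rfl
    · simp only [slitPairLift, hs1, ← hs, neg_mul, h1]
      simp [← hI]
      ring

lemma isPathConnected_strip_inter_strip {i j : Fin 3} (hij : i ≠ j) (k l : ℤ) :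
    IsPathConnected (strip i k ∩ strip j l) := by
  obtain ⟨e, he, he'⟩ := exists_homeomorph hij k l
  rw [← he, ← he', ← Set.preimage_inter, Homeomorph.isPathConnected_preimage]
  have hrange : ∀ n, IsPathConnected (Set.range (slitPairLift n)) := fun n ↦
    have := isPathConnected_iff_pathConnectedSpace.1 (isPathConnected_slitPair n)
    isPathConnected_range (continuous_slitPairLift n)
  have hsub : ∀ n, Set.range (slitPairLift n) ⊆ strip 0 0 ∩ strip 1 0 := by
    rintro n _ ⟨q, rfl⟩
    exact slitPairLift_mem n q
  obtain ⟨x, hx⟩ := (hrange 0).nonempty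
  have key : ∀ n, ∀ y ∈ Set.range (slitPairLift n), JoinedIn (strip 0 0 ∩ strip 1 0) x y := by
    intro n
    induction n using Int.induction_on with
    | zero => exact fun y hy ↦ ((hrange 0).joinedIn x hx y hy).mono (hsub 0)
    | succ n ih =>
      intro y hy
      obtain ⟨z, hz, hz'⟩ := slitPairLift_inter n
      exact (ih z hz).trans (((hrange _).joinedIn z hz' y hy).mono (hsub _))
    | pred n ih =>
      intro y hy
      obtain ⟨z, hz, hz'⟩ := slitPairLift_inter (-n - 1)
      rw [sub_add_cancel] at hz'
      exact (ih z hz').trans (((hrange _).joinedIn z hz y hy).mono (hsub _))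
  refine ⟨x, hsub 0 hx, fun {y} hy ↦ ?_⟩
  obtain ⟨n, q, rfl⟩ := exists_slitPairLift_eq hy
  exact key n _ ⟨q, rfl⟩

instance : SimplyConnectedSpace logCover := by
  choose p hp using exists_forall_mem_strip
  exact .of_three_families strip isOpen_strip isSimplyConnected_strip
    (fun _ _ _ _ ↦ strip_disjoint) (fun _ _ k l hij ↦ isPathConnected_strip_inter_strip hij k l)
    p hp exists_mem_strip

/-- The covering map from the logarithmic cover, given by exponentials of coordinates. -/
noncomputable def expMap : logCover → planeComplement :=
  planeComplement.restrictPreimage fun (f : Fin 3 → ℂ) i ↦ exp (f i)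

lemma isQuotientMap_expMap : Topology.IsQuotientMap expMap := by
  have h : Continuous fun (f : Fin 3 → ℂ) i ↦ exp (f i) := by fun_prop
  refine IsOpenMap.isQuotientMap ?_ h.restrictPreimage ?_
  · exact (IsOpenMap.piMap (fun _ ↦ isOpenMap_exp) (by simp)).restrictPreimage _
  · intro y
    have hy : (fun i ↦ exp (log (y.1 i))) = y.1 := funext fun i ↦ exp_log (y.2.2 i)
    exact ⟨⟨fun i ↦ log (y.1 i), by simpa only [logCover, Set.mem_preimage, hy] using y.2⟩,
      Subtype.ext hy⟩

lemma isAddQuotientCoveringMap_expMap : IsAddQuotientCoveringMap expMap (Fin 3 → ℤ) where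
  toIsQuotientMap := isQuotientMap_expMap
  apply_eq_iff_mem_orbit {f g} := by
    have h : expMap f = expMap g ↔ ∀ i, ∃ n : ℤ, f.1 i = g.1 i + n * (2 * Real.pi * I) := by
      simp only [← exp_eq_exp_iff_exists_int]
      rw [Subtype.ext_iff, funext_iff]
      rfl
    rw [h, Classical.skolem]
    exact exists_congr fun v ↦ ⟨fun hv ↦ Subtype.ext (funext fun i ↦ (hv i).symm),
      fun hv i ↦ hv ▸ rfl⟩
  disjoint e := by
    refine ⟨{f | ∀ i, |(f.1 i).im - (e.1 i).im| < Real.pi}, IsOpen.mem_nhds ?_ ?_, ?_⟩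
    · simp only [Set.ofPred_forall]
      exact isOpen_iInter_of_finite fun i ↦
        isOpen_lt ((continuous_im.comp (continuous_coord i)).sub continuous_const).abs
          continuous_const
    · simp [pi_pos]
    · rintro v ⟨_, ⟨f, hf, rfl⟩, hvf⟩
      ext i
      have h1 := hf i
      have h2 := hvf i
      rw [vadd_apply, add_two_pi_mul_int_im] at h2
      rw [abs_lt] at h1 h2
      have h3 : (v i : ℝ) < 1 := by nlinarith [pi_pos]
      have h4 : (-1 : ℝ) < v i := by nlinarith [pi_pos]
      norm_cast at h3
      have h5 : -1 < v i := by exact_mod_cast h4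
      simp only [Pi.zero_apply]
      lia

end logCover

/-- Projection to the first two coordinates identifies `planeComplement` with the complement of
three lines in `ℂ × ℂ`. -/
def planeComplementHomeomorph :
    planeComplement ≃ₜ {p : ℂ × ℂ | p.1 ≠ 0 ∧ p.2 ≠ 0 ∧ p.1 + p.2 ≠ 1} where
  toFun y := ⟨(y.1 0, y.1 1), y.2.2 0, y.2.2 1, fun h ↦ y.2.2 2 (by
    have := y.2.1
    rw [Fin.sum_univ_three, h] at this
    simpa using this)⟩
  invFun p := ⟨![p.1.1, p.1.2, 1 - p.1.1 - p.1.2], by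
    refine ⟨by simp [Fin.sum_univ_three], fun i ↦ ?_⟩
    fin_cases i
    · exact p.2.1
    · exact p.2.2.1
    · exact fun h ↦ p.2.2.2 (by
        change 1 - p.1.1 - p.1.2 = 0 at h
        linear_combination -h)⟩
  left_inv y := by
    have h := y.2.1
    rw [Fin.sum_univ_three] at h
    ext i
    fin_cases i
    · rfl
    · rfl
    · change 1 - y.1 0 - y.1 1 = y.1 2
      linear_combination -h
  right_inv p := rfl
  continuous_toFun := by
    have h (i : Fin 3) : Continuous fun y : planeComplement ↦ y.1 i :=
      (continuous_apply i).comp continuous_subtype_val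
    exact .subtype_mk ((h 0).prodMk (h 1)) _
  continuous_invFun := by
    refine .subtype_mk (continuous_pi fun i ↦ ?_) _
    fin_cases i
    · exact continuous_fst.comp continuous_subtype_val
    · exact continuous_snd.comp continuous_subtype_val
    · exact (continuous_const.sub (continuous_fst.comp continuous_subtype_val)).sub
        (continuous_snd.comp continuous_subtype_val)

end Complex

/-- The fundamental group of the complement
`M = {(z,w) ∈ ℂ² : z ≠ 0, w ≠ 0, z + w ≠ 1}` of the arrangement of the three
lines `x = 0`, `y = 0`, `x + y = 1` in `ℂ²` is free abelian of rank three. -/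
theorem fundamentalGroup_of_hattori_complement
    (M : Set (ℂ × ℂ))
    (hM : M = {p : ℂ × ℂ | p.1 ≠ 0 ∧ p.2 ≠ 0 ∧ p.1 + p.2 ≠ 1})
    (m : M) :
    Nonempty (FundamentalGroup M m ≃* Multiplicative (Fin 3 → ℤ)) := by
  subst hM
  have h := Complex.logCover.isAddQuotientCoveringMap_expMap.homeomorph_comp
    Complex.planeComplementHomeomorph
  obtain ⟨e, he⟩ := h.surjective m
  exact ⟨(h.fundamentalGroupEquiv ⟨e, he⟩).trans MulOpposite.opMulEquiv.symm⟩
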